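/- If there is a permutation π of the 2n+3 jobs of instance I whose total completion time satisfies F(π) ≤ Q0 + B, then there is a subset X_1 ⊆ {1,…,n} with Σ_{i∈X_1} x_i = B. -/

import Mathlib

/-- Completion time of the `i`-th scheduled job (0-based) in the normalized form:
`C_i(π) = Σ_{j ≤ i} p_{π_j} + max(0, Σ_{j ≤ i} δ_{π_j} - ML0)`. -/
def complTime (N : ℕ) (p δ : ℕ → ℤ) (ML0 : ℤ) (π : Equiv.Perm (Fin N)) (i : Fin N) : ℤ :=
  (∑ j ∈ Finset.Iic i, p ((π j : ℕ))) + max 0 ((∑ j ∈ Finset.Iic i, δ ((π j : ℕ))) - ML0)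

/-- Total completion time `F(π) = Σ_i C_i(π)`. -/
def totalCompl (N : ℕ) (p δ : ℕ → ℤ) (ML0 : ℤ) (π : Equiv.Perm (Fin N)) : ℤ :=
  ∑ i : Fin N, complTime N p δ ML0 π i

open Finset in
theorem sum_range_sum_range_succ (f : ℕ → ℤ) (K : ℕ) :
    ∑ i ∈ range K, ∑ j ∈ range (i + 1), f j = ∑ j ∈ range K, ((K : ℤ) - j) * f j := by
  induction K with
  | zero => simp
  | succ K ih =>
    have h : ∀ j ∈ range K, (((K + 1 : ℕ) : ℤ) - j) * f j = ((K : ℤ) - j) * f j + f j := by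
      intro j _
      push_cast
      ring
    rw [sum_range_succ, ih, sum_range_succ _ K, sum_range_succ _ K, sum_congr rfl h,
      sum_add_distrib]
    push_cast
    ring

open Finset in
theorem sum_prefix_sub_sum_prefix (f : ℕ → ℤ) (n : ℕ) :
    ∑ i ∈ range (n + 1), ∑ j ∈ range (i + 1), f j
      - ∑ i ∈ range (n + 2), ∑ j ∈ range (n + 1 + i + 1), f j
      = -(∑ j ∈ range (n + 1), ((j : ℤ) + 1) * f j
        + ∑ j ∈ range (n + 2), ((n : ℤ) + 2 - j) * f (n + 1 + j)) := by
  have h1 : ∀ i ∈ range (n + 2), ∑ j ∈ range (n + 1 + i + 1), f j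
      = ∑ j ∈ range (n + 1), f j + ∑ j ∈ range (i + 1), f (n + 1 + j) := by
    intro i _
    rw [add_assoc, sum_range_add]
  have h2 : ∑ j ∈ range (n + 1), ((j : ℤ) + 1) * f j
      = ((n : ℤ) + 2) * ∑ j ∈ range (n + 1), f j
        - ∑ j ∈ range (n + 1), (((n + 1 : ℕ) : ℤ) - j) * f j := by
    rw [mul_sum, ← sum_sub_distrib]
    refine sum_congr rfl fun j _ => ?_
    push_cast
    ring
  rw [sum_congr rfl h1, sum_add_distrib, sum_range_sum_range_succ,
    sum_range_sum_range_succ (fun j => f (n + 1 + j)), h2]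
  simp only [sum_const, card_range, nsmul_eq_mul]
  push_cast
  ring

open Finset in
theorem two_mul_sum_succ_mul_le (f : ℕ → ℤ) (hf : ∀ k, f k = 0 ∨ f k = 1) (N : ℕ) :
    0 ≤ ∑ k ∈ range N, f k ∧
    2 * ∑ k ∈ range N, ((k : ℤ) + 1) * f k
      ≤ (∑ k ∈ range N, f k) * (2 * N + 1 - ∑ k ∈ range N, f k) := by
  induction N with
  | zero => simp
  | succ N ih =>
    obtain ⟨h0, h1⟩ := ih
    rw [sum_range_succ, sum_range_succ]
    push_cast
    rcases hf N with h | h <;> rw [h] <;> constructor <;> nlinarith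

open Finset in
theorem two_mul_sum_sub_mul_le (f : ℕ → ℤ) (hf : ∀ k, f k = 0 ∨ f k = 1) (N : ℕ) :
    2 * ∑ k ∈ range N, ((N : ℤ) - k) * f k
      ≤ (∑ k ∈ range N, f k) * (2 * N + 1 - ∑ k ∈ range N, f k) := by
  have h := (two_mul_sum_succ_mul_le (fun k => f (N - 1 - k)) (fun k => hf _) N).2
  rw [sum_range_reflect f N, ← sum_range_reflect] at h
  refine le_trans (le_of_eq ?_) h
  congr 1
  refine sum_congr rfl fun k hk => ?_
  have hk := mem_range.1 hk
  have e1 : N - 1 - (N - 1 - k) = k := by omega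
  have e2 : ((N - 1 - k : ℕ) : ℤ) = N - 1 - k := by omega
  rw [e1, e2]
  ring

open Finset in
theorem sum_range_ite_le (l K : ℕ) (h : l ≤ K) :
    ∑ j ∈ range K, (if l ≤ j then (1 : ℤ) else 0) = K - l := by
  induction K, h using Nat.le_induction with
  | base =>
    rw [sub_self]
    refine sum_eq_zero fun j hj => if_neg ?_
    have := mem_range.1 hj
    omega
  | succ K hK ih =>
    rw [sum_range_succ, ih, if_pos hK]
    push_cast
    ring

open Finset in
theorem two_mul_sum_range_succ_mul_ite_le (l K : ℕ) (h : l ≤ K) :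
    2 * ∑ j ∈ range K, ((j : ℤ) + 1) * (if l ≤ j then (1 : ℤ) else 0)
      = K * (K + 1) - l * (l + 1) := by
  induction K, h using Nat.le_induction with
  | base =>
    rw [sub_self]
    refine mul_eq_zero_of_right _ (sum_eq_zero fun j hj => ?_)
    have := mem_range.1 hj
    rw [if_neg (by omega), mul_zero]
  | succ K hK ih =>
    rw [sum_range_succ, mul_add, ih, if_pos hK]
    push_cast
    ring

open Finset in
theorem sum_Icc_eq_sum_ite (x : ℕ → ℤ) (n k : ℕ) (h : k ≤ n) :
    ∑ l ∈ Icc 1 k, x l = ∑ l ∈ Icc 1 n, x l * (if l ≤ k then 1 else 0) := by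
  simp only [mul_ite, mul_one, mul_zero]
  rw [← sum_filter]
  refine sum_congr ?_ fun _ _ => rfl
  ext l
  simp only [mem_Icc, mem_filter]
  omega

open Finset in
theorem sum_mul_sum_Icc (x : ℕ → ℤ) (n : ℕ) (w : ℕ → ℤ) (d : ℕ → ℕ) (s : Finset ℕ)
    (hd : ∀ j ∈ s, d j ≤ n) :
    ∑ j ∈ s, w j * ∑ l ∈ Icc 1 (d j), x l
      = ∑ l ∈ Icc 1 n, x l * ∑ j ∈ s, w j * (if l ≤ d j then 1 else 0) := by
  simp only [mul_sum (s := s)]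
  rw [sum_comm]
  refine sum_congr rfl fun j hj => ?_
  rw [sum_Icc_eq_sum_ite x n (d j) (hd j hj), mul_sum]
  refine sum_congr rfl fun l _ => ?_
  ring

/-- The excess, over the balanced value, of the number of the first `n + 1` positions whose
index under `d` is at least `l`. -/
def excess (n : ℕ) (d : ℕ → ℕ) (l : ℕ) : ℤ :=
  (∑ j ∈ Finset.range (n + 1), if l ≤ d j then (1 : ℤ) else 0) - ((n : ℤ) + 1 - l)

open Finset in
theorem weighted_count_le (n l : ℕ) (d : ℕ → ℕ) (hl : l ≤ n)
    (hcard : ∑ j ∈ range (2 * n + 3), (if l ≤ d j then (1 : ℤ) else 0)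
      = 2 * ((n : ℤ) + 1 - l) + 1) :
    ∑ j ∈ range (n + 1), ((j : ℤ) + 1) * (if l ≤ d j then (1 : ℤ) else 0)
      + ∑ j ∈ range (n + 2), ((n : ℤ) + 2 - j) * (if l ≤ d (n + 1 + j) then (1 : ℤ) else 0)
      ≤ 2 * ∑ j ∈ range (n + 1), ((j : ℤ) + 1) * (if l ≤ j then (1 : ℤ) else 0)
        + (n + 2) - excess n d l ^ 2 := by
  have h01 : ∀ k, (if l ≤ d k then (1 : ℤ) else 0) = 0 ∨ (if l ≤ d k then (1 : ℤ) else 0) = 1 := by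
    intro k
    split_ifs <;> simp
  have h1 := (two_mul_sum_succ_mul_le _ h01 (n + 1)).2
  have h2 := two_mul_sum_sub_mul_le (fun k => if l ≤ d (n + 1 + k) then (1 : ℤ) else 0)
    (fun k => h01 _) (n + 2)
  rw [show 2 * n + 3 = (n + 1) + (n + 2) by ring, sum_range_add] at hcard
  rw [two_mul_sum_range_succ_mul_ite_le l (n + 1) (by omega)]
  have hr : ∑ j ∈ range (n + 1), (if l ≤ d j then (1 : ℤ) else 0)
      = excess n d l + ((n : ℤ) + 1 - l) := by
    unfold excess
    ring
  generalize excess n d l = e at *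
  have hs : ∑ j ∈ range (n + 2), (if l ≤ d (n + 1 + j) then (1 : ℤ) else 0)
      = ((n : ℤ) + 1 - l) + 1 - e := by linarith
  rw [hr] at h1
  rw [hs] at h2
  push_cast at h1 h2 ⊢
  nlinarith

open Finset in
theorem weighted_sum_le (n : ℕ) (x : ℕ → ℤ) (hx : ∀ i, 1 ≤ i → i ≤ n → 0 < x i)
    (d : ℕ → ℕ) (hd : ∀ j < 2 * n + 3, d j ≤ n)
    (hcard : ∀ l, 1 ≤ l → l ≤ n → ∑ j ∈ range (2 * n + 3), (if l ≤ d j then (1 : ℤ) else 0)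
      = 2 * ((n : ℤ) + 1 - l) + 1) :
    ∑ j ∈ range (n + 1), ((j : ℤ) + 1) * ∑ l ∈ Icc 1 (d j), x l
      + ∑ j ∈ range (n + 2), ((n : ℤ) + 2 - j) * ∑ l ∈ Icc 1 (d (n + 1 + j)), x l
      ≤ 2 * ∑ j ∈ range (n + 1), ((j : ℤ) + 1) * ∑ l ∈ Icc 1 j, x l
        + (n + 2) * ∑ l ∈ Icc 1 n, x l - ∑ l ∈ Icc 1 n, x l * excess n d l ^ 2 := by
  rw [sum_mul_sum_Icc x n _ d _ fun j hj => hd j (by have := mem_range.1 hj; omega),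
    sum_mul_sum_Icc x n _ (fun j => d (n + 1 + j)) _
      fun j hj => hd _ (by have := mem_range.1 hj; omega),
    sum_mul_sum_Icc x n _ (fun j => j) _ fun j hj => by have := mem_range.1 hj; omega,
    mul_sum, mul_sum, ← sum_add_distrib, ← sum_add_distrib, ← sum_sub_distrib]
  refine sum_le_sum fun l hl => ?_
  obtain ⟨hl1, hl2⟩ := mem_Icc.1 hl
  nlinarith [mul_le_mul_of_nonneg_left (weighted_count_le n l d hl2 (hcard l hl1 hl2))
    (hx l hl1 hl2).le]

open Finset in
theorem sum_mul_excess (n : ℕ) (x : ℕ → ℤ) (d : ℕ → ℕ) (hd : ∀ j < n + 1, d j ≤ n) :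
    ∑ l ∈ Icc 1 n, x l * excess n d l
      = ∑ j ∈ range (n + 1), ∑ l ∈ Icc 1 (d j), x l
        - ∑ j ∈ range (n + 1), ∑ l ∈ Icc 1 j, x l := by
  have h1 := sum_mul_sum_Icc x n (fun _ => 1) d (range (n + 1))
    fun j hj => hd j (mem_range.1 hj)
  have h2 := sum_mul_sum_Icc x n (fun _ => 1) (fun j => j) (range (n + 1))
    fun j hj => by have := mem_range.1 hj; omega
  simp only [one_mul] at h1 h2
  rw [h1, h2, ← sum_sub_distrib]
  refine sum_congr rfl fun l hl => ?_
  have := (mem_Icc.1 hl).2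
  rw [sum_range_ite_le l (n + 1) (by omega)]
  unfold excess
  push_cast
  ring

/-- The position of a job in the list `x₁, …, xₙ`: copies share the index of the original, and
the job `2n + 2` gets index `n`. -/
def jobIndex (n v : ℕ) : ℕ :=
  if v ≤ n then v else if v ≤ 2 * n + 1 then v - (n + 1) else n

theorem jobIndex_le (n v : ℕ) : jobIndex n v ≤ n := by
  unfold jobIndex
  split_ifs <;> omega

open Finset in
theorem sum_ite_le_jobIndex (n l : ℕ) (hl : l ≤ n) :
    ∑ v ∈ range (2 * n + 3), (if l ≤ jobIndex n v then (1 : ℤ) else 0)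
      = 2 * ((n : ℤ) + 1 - l) + 1 := by
  have h1 : ∀ v ∈ range (n + 1), (if l ≤ jobIndex n v then (1 : ℤ) else 0)
      = if l ≤ v then 1 else 0 := by
    intro v hv
    have := mem_range.1 hv
    rw [show jobIndex n v = v from if_pos (by omega)]
  have h2 : ∀ v ∈ range (n + 1), (if l ≤ jobIndex n (n + 1 + v) then (1 : ℤ) else 0)
      = if l ≤ v then 1 else 0 := by
    intro v hv
    have := mem_range.1 hv
    have : jobIndex n (n + 1 + v) = v := by
      rw [jobIndex, if_neg (by omega), if_pos (by omega), Nat.add_sub_cancel_left]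
    rw [this]
  have h3 : jobIndex n (n + 1 + (n + 1)) = n := by
    rw [jobIndex, if_neg (by omega), if_neg (by omega)]
  rw [show 2 * n + 3 = (n + 1) + (n + 1) + 1 by ring, sum_range_succ, sum_range_add,
    sum_congr rfl h1, sum_congr rfl h2, sum_range_ite_le l (n + 1) (by omega), h3, if_pos hl]
  push_cast
  ring

/-- The job at position `k` of the schedule `π`, as a function on `ℕ`. -/
def jobAt {N : ℕ} (π : Equiv.Perm (Fin N)) (k : ℕ) : ℕ :=
  if h : k < N then (π ⟨k, h⟩ : ℕ) else 0

theorem jobAt_val {N : ℕ} (π : Equiv.Perm (Fin N)) (i : Fin N) : jobAt π i = π i := by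
  simp [jobAt]

theorem jobAt_lt {N : ℕ} (π : Equiv.Perm (Fin N)) {k : ℕ} (h : k < N) : jobAt π k < N := by
  simp [jobAt, h]

open Finset in
theorem sum_range_jobAt {N : ℕ} (π : Equiv.Perm (Fin N)) (φ : ℕ → ℤ) :
    ∑ k ∈ range N, φ (jobAt π k) = ∑ v ∈ range N, φ v := by
  rw [sum_range, sum_range]
  simp only [jobAt_val]
  exact Equiv.sum_comp π fun v => φ v

open Finset in
theorem sum_Iic_perm {N : ℕ} (π : Equiv.Perm (Fin N)) (φ : ℕ → ℤ) (i : Fin N) :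
    ∑ j ∈ Iic i, φ (π j) = ∑ j ∈ range (i + 1), φ (jobAt π j) := by
  rw [Nat.range_succ_eq_Iic, ← Fin.map_valEmbedding_Iic, sum_map]
  simp [jobAt_val]

open Finset in
theorem totalCompl_eq_sum_range (N : ℕ) (p δ : ℕ → ℤ) (ML0 : ℤ) (π : Equiv.Perm (Fin N)) :
    totalCompl N p δ ML0 π = ∑ i ∈ range N, (∑ j ∈ range (i + 1), p (jobAt π j)
      + max 0 (∑ j ∈ range (i + 1), δ (jobAt π j) - ML0)) := by
  rw [sum_range]
  simp only [totalCompl, complTime, sum_Iic_perm]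

open Finset in
theorem prefix_bound_le_sum (a b : ℕ → ℤ) (ML0 : ℤ) (n : ℕ) :
    ∑ i ∈ range (n + 1), ∑ j ∈ range (i + 1), a j
      + max 0 (∑ j ∈ range (n + 1), b j - ML0)
      + ∑ i ∈ range (n + 2), (∑ j ∈ range (n + 1 + i + 1), (a j + b j) - ML0)
      ≤ ∑ i ∈ range (2 * n + 3), (∑ j ∈ range (i + 1), a j
        + max 0 (∑ j ∈ range (i + 1), b j - ML0)) := by
  rw [show 2 * n + 3 = (n + 1) + (n + 2) by ring, sum_range_add _ (n + 1) (n + 2)]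
  apply add_le_add
  · rw [sum_add_distrib]
    refine add_le_add_right ?_ _
    exact single_le_sum (f := fun i => max 0 (∑ j ∈ range (i + 1), b j - ML0))
      (fun i _ => le_max_left _ _) (self_mem_range_succ n)
  · refine sum_le_sum fun i _ => ?_
    rw [sum_add_distrib, add_sub_assoc]
    exact add_le_add_right (le_max_right _ _) _

/-- A set of integer weights whose square-weighted sum is at most its weighted sum is the
indicator of a set. -/
theorem exists_subset_sum_eq {s : Finset ℕ} (x e : ℕ → ℤ) (hx : ∀ l ∈ s, 0 < x l)
    (h : ∑ l ∈ s, x l * e l ^ 2 ≤ ∑ l ∈ s, x l * e l) :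
    ∃ t ⊆ s, ∑ l ∈ t, x l = ∑ l ∈ s, x l * e l := by
  have hnn : ∀ l ∈ s, 0 ≤ x l * e l ^ 2 - x l * e l := by
    intro l hl
    have : e l ≤ e l ^ 2 := Int.le_self_sq (e l)
    nlinarith [hx l hl]
  have h0 := (Finset.sum_eq_zero_iff_of_nonneg hnn).1
    (le_antisymm (by rw [Finset.sum_sub_distrib]; linarith) (Finset.sum_nonneg hnn))
  refine ⟨s.filter fun l => e l = 1, Finset.filter_subset _ _, ?_⟩
  rw [Finset.sum_filter]
  refine Finset.sum_congr rfl fun l hl => ?_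
  have h1 : x l * (e l * (e l - 1)) = 0 := by linear_combination h0 l hl
  rcases mul_eq_zero.1 ((mul_eq_zero.1 h1).resolve_left (hx l hl).ne') with h2 | h2
  · simp [h2]
  · simp [sub_eq_zero.1 h2]

/-- if some schedule of the `2n+3` jobs of instance `I` has total
completion time at most `Q0 + B`, then some subset `X₁ ⊆ {1,…,n}` of the Partition
instance sums to `B`. -/
theorem stmt10
    (n : ℕ) (x : ℕ → ℤ) (B M : ℤ)
    (hx : ∀ i, 1 ≤ i → i ≤ n → 0 < x i)
    (hB : ∑ i ∈ Finset.Icc 1 n, x i = 2 * B)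
    (hM : (4 * (n : ℤ) + 8) * B < M)
    (p δ : ℕ → ℤ)
    (hp : ∀ i ≤ n, p i = ∑ j ∈ Finset.Icc 1 i, x j)
    (hp' : ∀ i ≤ n, p (n + 1 + i) = p i)
    (hplast : p (2 * n + 2) = M - 2 * B)
    (hδ : ∀ i ≤ n, δ i = M - 2 * p i)
    (hδ' : ∀ i ≤ n, δ (n + 1 + i) = δ i)
    (hδlast : δ (2 * n + 2) = 0)
    (ML0 : ℤ) (hML0 : ML0 = (∑ i ∈ Finset.range (n + 1), δ i) - 2 * B)
    (Q0 : ℤ)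
    (hQ0 : Q0 = (∑ j ∈ Finset.range (n + 1), ((n : ℤ) - (j : ℤ) + 1) * p j)
      + ((n : ℤ) + 2) * ((∑ j ∈ Finset.range (n + 1), p j) + 2 * B + p (2 * n + 2))
      + (∑ j ∈ Finset.range (n + 1), ((j : ℤ) + 1) * (p j + δ j)))
    (hsched : ∃ π : Equiv.Perm (Fin (2 * n + 3)),
      totalCompl (2 * n + 3) p δ ML0 π ≤ Q0 + B) :
    ∃ X₁ : Finset ℕ, X₁ ⊆ Finset.Icc 1 n ∧ ∑ i ∈ X₁, x i = B := by
  obtain ⟨π, hF⟩ := hsched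
  set g := jobAt π
  set d : ℕ → ℕ := fun j => jobIndex n (g j)
  set q : ℕ → ℤ := fun v => ∑ l ∈ Finset.Icc 1 (jobIndex n v), x l with hq
  have hpq : ∀ v < 2 * n + 2, p v = q v ∧ δ v = M - 2 * q v := by
    intro v hv
    by_cases h : v ≤ n
    · have : q v = p v := by simp only [hq, jobIndex, if_pos h, hp v h]
      exact ⟨this.symm, by rw [this, hδ v h]⟩
    · obtain ⟨i, rfl⟩ : ∃ i, v = n + 1 + i := ⟨v - (n + 1), by omega⟩
      have hi : i ≤ n := by omega
      have : q (n + 1 + i) = p i := by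
        simp only [hq, jobIndex, if_neg h, if_pos (show n + 1 + i ≤ 2 * n + 1 by omega),
          Nat.add_sub_cancel_left, hp i hi]
      exact ⟨by rw [this, hp' i hi], by rw [this, hδ' i hi, hδ i hi]⟩
  have hqlast : q (2 * n + 2) = 2 * B := by
    simp only [hq, jobIndex, if_neg (show ¬ 2 * n + 2 ≤ n by omega),
      if_neg (show ¬ 2 * n + 2 ≤ 2 * n + 1 by omega), hB]
  have hB0 : 0 ≤ B := by
    have : 0 ≤ ∑ i ∈ Finset.Icc 1 n, x i := Finset.sum_nonneg fun i hi =>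
      (hx i (Finset.mem_Icc.1 hi).1 (Finset.mem_Icc.1 hi).2).le
    linarith
  have hM8 : 8 * B < M := by nlinarith [mul_nonneg (Int.natCast_nonneg n) hB0]
  have hqp : ∀ v < 2 * n + 3, q v ≤ p v := by
    intro v hv
    by_cases h : v = 2 * n + 2
    · rw [h, hqlast, hplast]
      linarith
    · exact (hpq v (by omega)).1.ge
  have hsum : ∀ v < 2 * n + 3, p v + δ v = M - q v := by
    intro v hv
    by_cases h : v = 2 * n + 2
    · rw [h, hqlast, hplast, hδlast]
      ring
    · rw [(hpq v (by omega)).1, (hpq v (by omega)).2]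
      ring
  have hcard : ∀ l, 1 ≤ l → l ≤ n →
      ∑ j ∈ Finset.range (2 * n + 3), (if l ≤ d j then (1 : ℤ) else 0)
        = 2 * ((n : ℤ) + 1 - l) + 1 := by
    intro l _ hl
    rw [← sum_ite_le_jobIndex n l hl]
    exact sum_range_jobAt π fun v => if l ≤ jobIndex n v then (1 : ℤ) else 0
  have hpx : ∀ w : ℕ → ℤ, ∑ j ∈ Finset.range (n + 1), w j * ∑ l ∈ Finset.Icc 1 j, x l
      = ∑ j ∈ Finset.range (n + 1), w j * p j := by
    intro w
    refine Finset.sum_congr rfl fun j hj => ?_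
    rw [hp j (by have := Finset.mem_range.1 hj; omega)]
  have hweight := weighted_sum_le n x hx d (fun j _ => jobIndex_le n _) hcard
  have hexcess := sum_mul_excess n x d (fun j _ => jobIndex_le n _)
  have hpx1 := hpx fun _ => 1
  simp only [one_mul] at hpx1
  rw [hpx, hB] at hweight
  rw [hpx1] at hexcess
  have hprefix := sum_prefix_sub_sum_prefix (fun j => q (g j)) n
  have hδsum : ∑ i ∈ Finset.range (n + 1), δ i
      = (n + 1) * M - 2 * ∑ i ∈ Finset.range (n + 1), p i := by
    rw [Finset.sum_congr rfl fun i hi => hδ i (by have := Finset.mem_range.1 hi; omega),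
      Finset.sum_sub_distrib, Finset.mul_sum]
    simp
  have hQ : Q0 = 2 * (n + 2) * (∑ j ∈ Finset.range (n + 1), p j)
      - 2 * (∑ j ∈ Finset.range (n + 1), ((j : ℤ) + 1) * p j)
      + M * ∑ j ∈ Finset.range (n + 2), ((j : ℤ) + 1) := by
    have h1 : ∑ j ∈ Finset.range (n + 1), ((n : ℤ) - (j : ℤ) + 1) * p j
        = (n + 2) * (∑ j ∈ Finset.range (n + 1), p j)
          - ∑ j ∈ Finset.range (n + 1), ((j : ℤ) + 1) * p j := by
      rw [Finset.mul_sum, ← Finset.sum_sub_distrib]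
      exact Finset.sum_congr rfl fun j _ => by ring
    have h2 : ∑ j ∈ Finset.range (n + 1), ((j : ℤ) + 1) * (p j + δ j)
        = M * (∑ j ∈ Finset.range (n + 1), ((j : ℤ) + 1))
          - ∑ j ∈ Finset.range (n + 1), ((j : ℤ) + 1) * p j := by
      rw [Finset.mul_sum, ← Finset.sum_sub_distrib]
      refine Finset.sum_congr rfl fun j hj => ?_
      rw [hδ j (by have := Finset.mem_range.1 hj; omega)]
      ring
    rw [hQ0, h1, h2, hplast, Finset.sum_range_succ _ (n + 1)]
    push_cast
    ring
  have hlate : ∑ i ∈ Finset.range (n + 2),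
        (∑ j ∈ Finset.range (n + 1 + i + 1), (p (g j) + δ (g j)) - ML0)
      = M * (∑ j ∈ Finset.range (n + 2), ((j : ℤ) + 1))
        + (n + 2) * (2 * (∑ j ∈ Finset.range (n + 1), p j) + 2 * B)
        - ∑ i ∈ Finset.range (n + 2), ∑ j ∈ Finset.range (n + 1 + i + 1), q (g j) := by
    have h1 : ∀ i ∈ Finset.range (n + 2),
        ∑ j ∈ Finset.range (n + 1 + i + 1), (p (g j) + δ (g j)) - ML0
        = M * ((i : ℤ) + 1) + (2 * (∑ j ∈ Finset.range (n + 1), p j) + 2 * B)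
          - ∑ j ∈ Finset.range (n + 1 + i + 1), q (g j) := by
      intro i hi
      have hi := Finset.mem_range.1 hi
      rw [Finset.sum_congr rfl fun j hj => hsum (g j) (jobAt_lt π
        (by have := Finset.mem_range.1 hj; omega)), Finset.sum_sub_distrib, hML0, hδsum]
      simp only [Finset.sum_const, Finset.card_range, nsmul_eq_mul]
      push_cast
      ring
    rw [Finset.sum_congr rfl h1, Finset.sum_sub_distrib, Finset.sum_add_distrib, ← Finset.mul_sum]
    simp only [Finset.sum_const, Finset.card_range, nsmul_eq_mul]
    push_cast
    ring
  rw [totalCompl_eq_sum_range] at hF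
  have hbound := (prefix_bound_le_sum (fun j => p (g j)) (fun j => δ (g j)) ML0 n).trans hF
  simp only [hlate] at hbound
  have hsq : ∑ l ∈ Finset.Icc 1 n, x l * excess n d l
      ≤ ∑ l ∈ Finset.Icc 1 n, x l * excess n d l ^ 2 :=
    Finset.sum_le_sum fun l hl => mul_le_mul_of_nonneg_left (Int.le_self_sq _)
      (hx l (Finset.mem_Icc.1 hl).1 (Finset.mem_Icc.1 hl).2).le
  have hsq0 : 0 ≤ ∑ l ∈ Finset.Icc 1 n, x l * excess n d l ^ 2 :=
    Finset.sum_nonneg fun l hl => mul_nonneg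
      (hx l (Finset.mem_Icc.1 hl).1 (Finset.mem_Icc.1 hl).2).le (sq_nonneg _)
  by_cases hlast : ∃ t < n + 1, g t = 2 * n + 2
  · exfalso
    obtain ⟨t, ht, hgt⟩ := hlast
    have hle : ∀ i < n + 1, ∀ j ∈ Finset.range (i + 1), q (g j) ≤ p (g j) := fun i hi j hj =>
      hqp _ (jobAt_lt π (by have := Finset.mem_range.1 hj; omega))
    have h1 : M - 4 * B ≤ ∑ j ∈ Finset.range (n + 1), (p (g j) - q (g j)) := by
      have := Finset.single_le_sum (f := fun j => p (g j) - q (g j))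
        (fun j hj => sub_nonneg.2 (hle n (by omega) j hj)) (Finset.mem_range.2 ht)
      simp only [hgt, hplast, hqlast] at this
      linarith
    have h2 : ∑ j ∈ Finset.range (n + 1), (p (g j) - q (g j))
        ≤ ∑ i ∈ Finset.range (n + 1), ∑ j ∈ Finset.range (i + 1), (p (g j) - q (g j)) :=
      Finset.single_le_sum (f := fun i => ∑ j ∈ Finset.range (i + 1), (p (g j) - q (g j)))
        (fun i hi => Finset.sum_nonneg fun j hj =>
          sub_nonneg.2 (hle i (Finset.mem_range.1 hi) j hj)) (Finset.self_mem_range_succ n)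
    simp only [Finset.sum_sub_distrib] at h1 h2
    have h3 := le_max_left 0 (∑ j ∈ Finset.range (n + 1), δ (g j) - ML0)
    linarith
  · push Not at hlast
    have hfirst : ∀ j < n + 1, p (g j) = q (g j) ∧ δ (g j) = M - 2 * q (g j) := by
      intro j hj
      have h1 := hlast j hj
      have h2 : g j < 2 * n + 3 := jobAt_lt π (by omega)
      exact hpq _ (by omega)
    have h1 : ∑ i ∈ Finset.range (n + 1), ∑ j ∈ Finset.range (i + 1), p (g j)
        = ∑ i ∈ Finset.range (n + 1), ∑ j ∈ Finset.range (i + 1), q (g j) := by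
      refine Finset.sum_congr rfl fun i hi => Finset.sum_congr rfl fun j hj => (hfirst j ?_).1
      have := Finset.mem_range.1 hi
      have := Finset.mem_range.1 hj
      omega
    have h2 : ∑ j ∈ Finset.range (n + 1), δ (g j)
        = (n + 1) * M - 2 * ∑ j ∈ Finset.range (n + 1), q (g j) := by
      rw [Finset.sum_congr rfl fun j hj => (hfirst j (Finset.mem_range.1 hj)).2,
        Finset.sum_sub_distrib, Finset.mul_sum]
      simp
    have h3 := le_max_left 0 (∑ j ∈ Finset.range (n + 1), δ (g j) - ML0)
    have h4 := le_max_right 0 (∑ j ∈ Finset.range (n + 1), δ (g j) - ML0)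
    have hD : ∑ l ∈ Finset.Icc 1 n, x l * excess n d l = B := by
      apply le_antisymm <;> linarith
    obtain ⟨X₁, hX, hXB⟩ := exists_subset_sum_eq x (excess n d)
      (fun l hl => hx l (Finset.mem_Icc.1 hl).1 (Finset.mem_Icc.1 hl).2) (by linarith)
    exact ⟨X₁, hX, hXB.trans hD⟩
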